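/- Let g ≥ 4 be even, n > g, and U_{n,g} as above with positive eigenvector X of B(U_{n,g}) for its largest eigenvalue μ ≥ 4.5. Then x_i > x_{g+i} for all 1 ≤ i ≤ min(g/2, n - g). -/

import Mathlib

open Matrix

/-- The unicyclic graph `U_{n,g}` on vertices `0, …, n-1` (vertex `i` here is
vertex `i+1` of the paper): a cycle on `0, …, g-1` together with a pendant path
`g-1, g, …, n-1` attached at the cycle vertex `g-1`. -/
def Ung (n g : ℕ) : SimpleGraph (Fin n) :=
  SimpleGraph.fromRel (fun a b => b.val = a.val + 1 ∨ (a.val = 0 ∧ b.val = g - 1))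

instance (n g : ℕ) : DecidableRel (Ung n g).Adj := fun a b =>
  decidable_of_iff _ (SimpleGraph.fromRel_adj _ a b).symm

theorem Ung_adj_iff (n g : ℕ) (a b : Fin n) : (Ung n g).Adj a b ↔
    a ≠ b ∧ ((b.val = a.val + 1 ∨ (a.val = 0 ∧ b.val = g - 1)) ∨
      (a.val = b.val + 1 ∨ (b.val = 0 ∧ a.val = g - 1))) := by
  unfold Ung
  rw [SimpleGraph.fromRel_adj]

theorem Ung_eig (n g : ℕ) (mu : ℝ) (X : Fin n → ℝ)
    (heig : ((Ung n g).degMatrix ℝ + (Ung n g).adjMatrix ℝ).mulVec X = mu • X)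
    (v : Fin n) (S : Finset (Fin n)) (hS : ∀ u, u ∈ S ↔ (Ung n g).Adj v u) :
    (S.card : ℝ) * X v + ∑ u ∈ S, X u = mu * X v := by
  have h := congrFun heig v
  have hN : (Ung n g).neighborFinset v = S := by
    ext u
    rw [SimpleGraph.mem_neighborFinset, hS]
  rw [Matrix.add_mulVec, Pi.add_apply, SimpleGraph.adjMatrix_mulVec_apply,
    SimpleGraph.degMatrix_mulVec_apply, ← SimpleGraph.card_neighborFinset_eq_degree, hN] at h
  simpa using h

theorem Ung_pair (n g : ℕ) (mu : ℝ) (X : Fin n → ℝ)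
    (heig : ((Ung n g).degMatrix ℝ + (Ung n g).adjMatrix ℝ).mulVec X = mu • X)
    (v a b : Fin n) (hab : a ≠ b) (hS : ∀ u, (u = a ∨ u = b) ↔ (Ung n g).Adj v u) :
    (mu - 2) * X v = X a + X b := by
  have h := Ung_eig n g mu X heig v {a, b} (by simpa using hS)
  rw [Finset.card_pair hab, Finset.sum_pair hab] at h
  push_cast at h
  linarith

/-- Proposition 3.1(v): in the paper's labelling (here shifted down by one),
if `μ ≥ 4.5` then `x_i > x_{g+i}` for `1 ≤ i ≤ min(g/2, n-g)`. -/
theorem stmt_17 (n g : ℕ) (hg : 4 ≤ g) (heven : Even g) (hng : g < n)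
    (mu : ℝ)
    (hmu : IsGreatest
      (spectrum ℝ ((Ung n g).degMatrix ℝ + (Ung n g).adjMatrix ℝ)) mu)
    (hmu45 : mu ≥ 4.5)
    (X : Fin n → ℝ) (hXpos : ∀ v, 0 < X v)
    (heig : ((Ung n g).degMatrix ℝ + (Ung n g).adjMatrix ℝ).mulVec X = mu • X) :
    ∀ (i : ℕ) (hi1 : 1 ≤ i) (hi2 : 2 * i ≤ g) (hi3 : i ≤ n - g),
      X ⟨i - 1, by omega⟩ > X ⟨g + i - 1, by omega⟩ := by
  obtain ⟨Y, hY⟩ : ∃ Y : ℕ → ℝ, ∀ k (h : k < n), Y k = X ⟨k, h⟩ :=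
    ⟨fun k => if h : k < n then X ⟨k, h⟩ else 0, fun k h => by simp [h]⟩
  have hpos : ∀ k, k < n → 0 < Y k := fun k h => by rw [hY k h]; exact hXpos _
  have hA : ∀ k, k + 2 < n → k + 1 ≠ g - 1 → (mu - 2) * Y (k + 1) = Y k + Y (k + 2) := by
    intro k hk hkg
    rw [hY k (by omega), hY (k + 1) (by omega), hY (k + 2) hk]
    apply Ung_pair n g mu X heig
    · simp
    · intro u
      rw [Ung_adj_iff]
      simp only [ne_eq, Fin.ext_iff]
      omega
  have hB : (mu - 2) * Y 0 = Y (g - 1) + Y 1 := by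
    rw [hY 0 (by omega), hY (g - 1) (by omega), hY 1 (by omega)]
    apply Ung_pair n g mu X heig
    · simp only [ne_eq, Fin.ext_iff]; omega
    · intro u
      rw [Ung_adj_iff]
      simp only [ne_eq, Fin.ext_iff, true_and]
      omega
  have hC : (mu - 1) * Y (n - 1) = Y (n - 2) := by
    rw [hY (n - 1) (by omega), hY (n - 2) (by omega)]
    have h := Ung_eig n g mu X heig ⟨n - 1, by omega⟩ {⟨n - 2, by omega⟩} (by
      intro u
      rw [Ung_adj_iff, Finset.mem_singleton]
      simp only [ne_eq, Fin.ext_iff]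
      omega)
    rw [Finset.card_singleton, Finset.sum_singleton] at h
    push_cast at h
    linarith
  obtain ⟨r, hr1, hr⟩ : ∃ r : ℝ, 1 < r ∧ r ^ 2 + 1 = (mu - 2) * r := by
    have hd : 0 ≤ (mu - 2) ^ 2 - 4 := by nlinarith
    refine ⟨((mu - 2) + √((mu - 2) ^ 2 - 4)) / 2, ?_, ?_⟩
    · have := Real.sqrt_nonneg ((mu - 2) ^ 2 - 4)
      norm_num at hmu45
      linarith
    · nlinarith [Real.sq_sqrt hd]
  have hr0 : 0 < r := by linarith
  -- the pendant path decays faster than the geometric rate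
  have hP : ∀ d k, k + d + 2 = n → g ≤ k + 1 → r * Y (k + 1) < Y k := by
    intro d
    induction d with
    | zero =>
      intro k hk hkg
      have e1 : n - 1 = k + 1 := by omega
      have e2 : n - 2 = k := by omega
      rw [e1, e2] at hC
      have hp := hpos (k + 1) (by omega)
      have : r < mu - 1 := by nlinarith
      rw [← hC]
      exact mul_lt_mul_of_pos_right this hp
    | succ d ih =>
      intro k hk hkg
      have h1 := ih (k + 1) (by omega) (by omega)
      have h2 := hA k (by omega) (by omega)
      have h3 : r * (r * Y (k + 1)) < r * Y k := by
        have : r * Y k = (r ^ 2 + 1) * Y (k + 1) - r * Y (k + 2) := by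
          rw [hr]; linear_combination (-r) * h2
        have e : k + 1 + 1 = k + 2 := rfl
        rw [e] at h1
        nlinarith
      exact lt_of_mul_lt_mul_left h3 hr0.le
  -- the quantity r * Y (k+1) - Y k is geometric along the cycle
  have hE : ∀ k, k + 1 ≤ g - 1 →
      r * Y (k + 1) - Y k = r ^ (k + 1) * (r * Y 0 - Y (g - 1)) := by
    intro k
    induction k with
    | zero =>
      intro _
      simp only [zero_add, pow_one]
      linear_combination (-r) * hB - Y 0 * hr
    | succ k ih =>
      intro hk
      have h1 := ih (by omega)
      have h2 := hA k (by omega) (by omega)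
      have e : k + 1 + 1 = k + 2 := rfl
      rw [pow_succ, e]
      linear_combination r * h1 - r * h2 - Y (k + 1) * hr
  have hE0 : 0 < r * Y 0 - Y (g - 1) := by
    by_contra hcon
    push Not at hcon
    have hdec : ∀ k, k ≤ g - 1 → Y k ≤ Y 0 := by
      intro k
      induction k with
      | zero => intro _; exact le_rfl
      | succ k ih =>
        intro hk
        have h1 := ih (by omega)
        have h2 := hE k hk
        have h3 : r ^ (k + 1) * (r * Y 0 - Y (g - 1)) ≤ 0 :=
          mul_nonpos_of_nonneg_of_nonpos (by positivity) hcon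
        have h4 := hpos (k + 1) (by omega)
        nlinarith
    have h1 := hdec (g - 1) le_rfl
    have h2 := hpos 0 (by omega)
    nlinarith
  have main : ∀ k, k + 1 ≤ g - 1 → g + k < n → Y (g + k) < Y k := by
    intro k
    induction k with
    | zero =>
      intro _ _
      have h := hP (n - g - 1) (g - 1) (by omega) (by omega)
      have e : g - 1 + 1 = g := by omega
      rw [e] at h
      rw [add_zero]
      exact lt_of_mul_lt_mul_left (by linarith) hr0.le
    | succ k ih =>
      intro hk hkn
      have h1 := ih (by omega) (by omega)
      have h2 := hP (n - (g + k) - 2) (g + k) (by omega) (by omega)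
      have h3 := hE k (by omega)
      have h4 : 0 < r ^ (k + 1) * (r * Y 0 - Y (g - 1)) := by positivity
      rw [← add_assoc]
      exact lt_of_mul_lt_mul_left (by linarith) hr0.le
  intro i hi1 hi2 hi3
  have h := main (i - 1) (by omega) (by omega)
  have e : g + (i - 1) = g + i - 1 := by omega
  rw [e, hY _ (by omega), hY _ (by omega)] at h
  exact h
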